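/- arXiv:2605.19055 — 2 statements merged into one kernel-verified Lean document; each statement's English description precedes it below -/
import Mathlib

section
/- Let R₂ | S₂ := (C₆* | C₆) ⊠ (C₆* | C₆), a conditional predicate of arity 4 over the domain {0,1,2}. There exists a constant C > 0 such that for infinitely many integers m there is a 4-partite non-redundant instance H = (V₁, V₂, V₃, V₄, E) of CSP(R₂ | S₂) with exactly m edges satisfying |π_I E| ≤ C · m^{5/6} for every proper subset I ⊊ [4]. -/
open Set

/-- `H = (V, E)` (with vertex type `V` and ordered hyperedges `E`) is a (conditionally)
non-redundant instance of `CSP(P | Q)`: for each edge `e` there is an assignment that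
`P`-satisfies every other edge but `Q \ P`-satisfies `e`.  For plain non-redundancy
take `Q = Set.univ`. -/
def IsNRDInstance {ι D V : Type*} (P Q : Set (ι → D)) (E : Set (ι → V)) : Prop :=
  ∀ e ∈ E, ∃ ψ : V → D,
    (∀ e' ∈ E, e' ≠ e → (fun i => ψ (e' i)) ∈ P) ∧ (fun i => ψ (e i)) ∈ Q \ P

/-- `NRD(P | Q, n)`: the maximum number of edges of a non-redundant instance of
`CSP(P | Q)` on `n` vertices. -/
noncomputable def NRD {ι D : Type*} (P Q : Set (ι → D)) (n : ℕ) : ℕ :=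
  sSup {m | ∃ E : Set (ι → Fin n), IsNRDInstance P Q E ∧ E.ncard = m}

/-- A partite non-redundant instance of `CSP(P | Q)`: the vertex set is the disjoint
union of the parts `V i`, and each edge selects one vertex from each part. -/
def IsPartiteNRDInstance {ι D : Type*} {V : ι → Type*} (P Q : Set (ι → D))
    (E : Set (∀ i, V i)) : Prop :=
  ∀ e ∈ E, ∃ ψ : ∀ i, V i → D,
    (∀ e' ∈ E, e' ≠ e → (fun i => ψ i (e' i)) ∈ P) ∧ (fun i => ψ i (e i)) ∈ Q \ P

/-- Projection `π_I` of a tuple onto the coordinates in `I`. -/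
def proj {ι : Type*} (I : Set ι) {X : ι → Type*} (e : ∀ i, X i) : ∀ i : I, X i.1 :=
  fun i => e i.1

/-- `P | Q` is an `𝓘`-substructure of `R | S`. -/
def IsSubstructure {ι₁ ι₂ D₁ D₂ : Type*} (P Q : Set (ι₁ → D₁)) (R S : Set (ι₂ → D₂))
    (𝓘 : ι₂ → Set ι₁) : Prop :=
  ∃ g : ∀ j : ι₂, (↥(𝓘 j) → D₁) → D₂,
    (∀ x ∈ P, (fun j => g j (fun i => x i.1)) ∈ R) ∧
    (∀ x ∈ Q \ P, (fun j => g j (fun i => x i.1)) ∈ S \ R)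

/-- The `Q`-part of the box product of conditional predicates. -/
def boxQ {ι₁ ι₂ D : Type*} (Q₁ : Set (ι₁ → D)) (Q₂ : Set (ι₂ → D)) : Set (ι₁ ⊕ ι₂ → D) :=
  {x | (fun i => x (Sum.inl i)) ∈ Q₁ ∧ (fun i => x (Sum.inr i)) ∈ Q₂}

/-- The `P`-part of the box product: `P₃ = (P₁ × Q₂) ∪ (Q₁ × P₂)`. -/
def boxP {ι₁ ι₂ D : Type*} (P₁ Q₁ : Set (ι₁ → D)) (P₂ Q₂ : Set (ι₂ → D)) :
    Set (ι₁ ⊕ ι₂ → D) :=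
  {x | ((fun i => x (Sum.inl i)) ∈ P₁ ∧ (fun i => x (Sum.inr i)) ∈ Q₂) ∨
       ((fun i => x (Sum.inl i)) ∈ Q₁ ∧ (fun i => x (Sum.inr i)) ∈ P₂)}

/-- The 6-cycle `C₆` as a binary predicate over `{0,1,2}`. -/
def C6 : Set (Fin 2 → Fin 3) := {![0,0], ![0,1], ![1,0], ![1,2], ![2,1], ![2,2]}

/-- `C₆* = C₆ ∖ {(0,0)}`. -/
def C6star : Set (Fin 2 → Fin 3) := C6 \ {![0,0]}

/-- The tuple with given entries. -/
def mkTup {X : Type} (a b c d : X) : Fin 2 ⊕ Fin 2 → X := Sum.elim ![a, b] ![c, d]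

/-- Point-line incidence in the affine plane. -/
def Inc (p : ℕ) (P L : ZMod p × ZMod p) : Prop := P.2 = L.1 * P.1 + L.2

/-- The point of a flag. -/
def flagPt (p : ℕ) (t : ZMod p × ZMod p × ZMod p) : ZMod p × ZMod p :=
  (t.1, t.2.1 * t.1 + t.2.2)

lemma inc_flag (p : ℕ) (P L : ZMod p × ZMod p) (h : Inc p P L) :
    flagPt p (P.1, L) = P := by
  unfold Inc at h
  ext <;> simp [flagPt, h]

lemma inc_c4_free (p : ℕ) [Fact p.Prime] (P P' L L' : ZMod p × ZMod p)
    (h1 : Inc p P L) (h2 : Inc p P L') (h3 : Inc p P' L) (h4 : Inc p P' L') :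
    P = P' ∨ L = L' := by
  unfold Inc at *
  have h : (L.1 - L'.1) * (P.1 - P'.1) = 0 := by linear_combination -h1 + h2 + h3 - h4
  rcases mul_eq_zero.1 h with h | h
  · right
    have e : L.1 = L'.1 := sub_eq_zero.1 h
    refine Prod.ext e ?_
    rw [e] at h1
    linear_combination h2 - h1
  · left
    have e : P.1 = P'.1 := sub_eq_zero.1 h
    refine Prod.ext e ?_
    rw [e] at h1
    rw [h1, h3]

open Classical in
/-- Each edge of the incidence graph can be singled out by a map to the six-cycle. -/
lemma exists_hom (p : ℕ) [Fact p.Prime] (P₀ L₀ : ZMod p × ZMod p) (h₀ : Inc p P₀ L₀) :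
    ∃ f g : ZMod p × ZMod p → Fin 3, f P₀ = 0 ∧ g L₀ = 0 ∧
      ∀ P L, Inc p P L → ![f P, g L] ∈ C6 ∧ (¬ (P = P₀ ∧ L = L₀) → ![f P, g L] ∈ C6star) := by
  refine ⟨fun P => if P = P₀ then 0 else if Inc p P L₀ then 1 else 2,
    fun L => if L = L₀ then 0 else if Inc p P₀ L then 1 else 2, by simp, by simp, ?_⟩
  intro P L h
  have key := inc_c4_free p P P₀ L L₀ h
  by_cases hP : P = P₀
  · subst hP
    by_cases hL : L = L₀
    · subst hL
      simp [C6]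
    · simp [hL, h, C6, C6star]
  · by_cases hL : L = L₀
    · subst hL
      simp [hP, h, C6, C6star]
    · by_cases h1 : Inc p P L₀
      · have h2 : ¬ Inc p P₀ L := fun h2 => by
          rcases key h1 h2 h₀ with h | h
          · exact hP h
          · exact hL h
        simp [hP, hL, h1, h2, C6, C6star]
      · by_cases h2 : Inc p P₀ L <;> simp [hP, hL, h1, h2, C6, C6star]

/-- The product of two copies of the incidence graph. -/
def prodE (p : ℕ) : Set (∀ _ : Fin 2 ⊕ Fin 2, ZMod p × ZMod p) :=
  {e | Inc p (e (Sum.inl 0)) (e (Sum.inl 1)) ∧ Inc p (e (Sum.inr 0)) (e (Sum.inr 1))}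

lemma eta2 {X : Type} (x : Fin 2 → X) : x = ![x 0, x 1] := by
  ext i
  fin_cases i <;> rfl

lemma prodE_nrd (p : ℕ) [Fact p.Prime] :
    IsPartiteNRDInstance (boxP C6star C6 C6star C6) (boxQ C6 C6) (prodE p) := by
  intro e he
  obtain ⟨f, g, hf, hg, h⟩ := exists_hom p _ _ he.1
  obtain ⟨f', g', hf', hg', h'⟩ := exists_hom p _ _ he.2
  refine ⟨Sum.elim ![f, g] ![f', g'], ?_, ?_⟩
  · intro e' he' hne
    have a := h _ _ he'.1
    have b := h' _ _ he'.2
    simp only [boxP, Set.mem_setOf_eq]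
    rw [eta2 (fun i => _), eta2 (fun i : Fin 2 => Sum.elim ![f, g] ![f', g'] (Sum.inr i) _)]
    simp only [Sum.elim_inl, Sum.elim_inr, Matrix.cons_val_zero, Matrix.cons_val_one]
    by_cases c : e' (Sum.inl 0) = e (Sum.inl 0) ∧ e' (Sum.inl 1) = e (Sum.inl 1)
    · right
      refine ⟨a.1, b.2 fun d => hne ?_⟩
      funext i
      rcases i with i | i <;> fin_cases i
      exacts [c.1, c.2, d.1, d.2]
    · left
      exact ⟨a.2 c, b.1⟩
  · simp only [boxP, boxQ, Set.mem_diff, Set.mem_setOf_eq]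
    rw [eta2 (fun i => _), eta2 (fun i : Fin 2 => Sum.elim ![f, g] ![f', g'] (Sum.inr i) _)]
    simp only [Sum.elim_inl, Sum.elim_inr, Matrix.cons_val_zero, Matrix.cons_val_one]
    rw [hf, hg, hf', hg']
    simp [C6, C6star]

lemma prodE_card (p : ℕ) [Fact p.Prime] : (prodE p).ncard = p ^ 6 := by
  let F : (ZMod p × ZMod p × ZMod p) × (ZMod p × ZMod p × ZMod p) →
      (∀ _ : Fin 2 ⊕ Fin 2, ZMod p × ZMod p) :=
    fun t => mkTup (flagPt p t.1) t.1.2 (flagPt p t.2) t.2.2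
  have hF : Function.Injective F := by
    intro s t h
    have h0 := congrFun h (Sum.inl 0)
    have h1 := congrFun h (Sum.inl 1)
    have h2 := congrFun h (Sum.inr 0)
    have h3 := congrFun h (Sum.inr 1)
    simp only [F, mkTup, Sum.elim_inl, Sum.elim_inr, Matrix.cons_val_zero,
      Matrix.cons_val_one] at h0 h1 h2 h3
    have k0 : s.1.1 = t.1.1 := (Prod.ext_iff.1 h0).1
    have k2 : s.2.1 = t.2.1 := (Prod.ext_iff.1 h2).1
    exact Prod.ext (Prod.ext k0 h1) (Prod.ext k2 h3)
  have hE : prodE p = Set.range F := by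
    ext e
    constructor
    · intro he
      refine ⟨(((e (Sum.inl 0)).1, e (Sum.inl 1)), ((e (Sum.inr 0)).1, e (Sum.inr 1))), ?_⟩
      funext i
      rcases i with i | i <;> fin_cases i
      exacts [inc_flag p _ _ he.1, rfl, inc_flag p _ _ he.2, rfl]
    · rintro ⟨t, rfl⟩
      exact ⟨rfl, rfl⟩
  rw [hE, ← Set.image_univ, Set.ncard_image_of_injective _ hF, Set.ncard_univ]
  simp only [Nat.card_prod, Nat.card_zmod]
  ring

lemma proj_card (p : ℕ) [Fact p.Prime] (I : Set (Fin 2 ⊕ Fin 2)) (i : Fin 2 ⊕ Fin 2)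
    (hi : i ∉ I)
    (G : (ZMod p × ZMod p) × (ZMod p × ZMod p × ZMod p) →
      (∀ _ : Fin 2 ⊕ Fin 2, ZMod p × ZMod p))
    (hG : ∀ e ∈ prodE p, ∃ s, ∀ j, j ≠ i → G s j = e j) :
    (proj I '' prodE p).ncard ≤ p ^ 5 := by
  have hsub : proj I '' prodE p ⊆ (fun s => proj I (G s)) '' Set.univ := by
    rintro _ ⟨e, he, rfl⟩
    obtain ⟨s, hs⟩ := hG e he
    refine ⟨s, trivial, ?_⟩
    funext j
    exact hs j.1 fun h => hi (h ▸ j.2)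
  refine (Set.ncard_le_ncard hsub (Set.toFinite _)).trans
    ((Set.ncard_image_le (Set.toFinite _)).trans ?_)
  rw [Set.ncard_univ]
  simp only [Nat.card_prod, Nat.card_zmod]
  exact le_of_eq (by ring)

lemma prodE_proj (p : ℕ) [Fact p.Prime] (I : Set (Fin 2 ⊕ Fin 2)) (hI : I ≠ Set.univ) :
    (proj I '' prodE p).ncard ≤ p ^ 5 := by
  obtain ⟨i, hi⟩ := (Set.ne_univ_iff_exists_notMem I).1 hI
  have key : ∃ G : (ZMod p × ZMod p) × (ZMod p × ZMod p × ZMod p) →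
      (∀ _ : Fin 2 ⊕ Fin 2, ZMod p × ZMod p),
      ∀ e ∈ prodE p, ∃ s, ∀ j, j ≠ i → G s j = e j := by
    rcases i with i | i
    · refine ⟨fun s => mkTup s.1 s.1 (flagPt p s.2) s.2.2, fun e he =>
        ⟨(e (Sum.inl (1 - i)), ((e (Sum.inr 0)).1, e (Sum.inr 1))), ?_⟩⟩
      have := inc_flag p _ _ he.2
      intro j hj
      rcases j with j | j <;> fin_cases j <;> fin_cases i <;> simp_all [mkTup]
    · refine ⟨fun s => mkTup (flagPt p s.2) s.2.2 s.1 s.1, fun e he =>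
        ⟨(e (Sum.inr (1 - i)), ((e (Sum.inl 0)).1, e (Sum.inl 1))), ?_⟩⟩
      have := inc_flag p _ _ he.1
      intro j hj
      rcases j with j | j <;> fin_cases j <;> fin_cases i <;> simp_all [mkTup]
  obtain ⟨G, hG⟩ := key
  exact proj_card p I i hi G hG

/-- Lemma: for infinitely many `m`, `CSP(R₂ | S₂)` with
`R₂ | S₂ = (C₆* | C₆) ⊠ (C₆* | C₆)` has a 4-partite non-redundant instance with exactly
`m` edges all of whose proper projections have at most `C · m^{5/6}` edges. -/
theorem R2S2_shrinking_instances :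
    ∃ C > (0:ℝ), ∀ m₀ : ℕ, ∃ m ≥ m₀,
      ∃ (V : Fin 2 ⊕ Fin 2 → Type) (_ : ∀ i, Finite (V i)) (E : Set (∀ i, V i)),
        IsPartiteNRDInstance (boxP C6star C6 C6star C6) (boxQ C6 C6) E ∧
        E.ncard = m ∧
        ∀ I : Set (Fin 2 ⊕ Fin 2), I ≠ Set.univ →
          ((proj I '' E).ncard : ℝ) ≤ C * (m : ℝ) ^ ((5:ℝ)/6) := by
  refine ⟨1, one_pos, fun m₀ => ?_⟩
  obtain ⟨p, hp, hpp⟩ := Nat.exists_infinite_primes m₀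
  haveI : Fact p.Prime := ⟨hpp⟩
  refine ⟨p ^ 6, hp.trans (Nat.le_self_pow (by norm_num) p), fun _ => ZMod p × ZMod p,
    fun _ => inferInstance, prodE p, prodE_nrd p, prodE_card p, fun I hI => ?_⟩
  have h : (((p ^ 6 : ℕ) : ℝ)) ^ ((5:ℝ)/6) = (p : ℝ) ^ 5 := by
    rw [Nat.cast_pow, ← Real.rpow_natCast, ← Real.rpow_mul (Nat.cast_nonneg p),
      ← Real.rpow_natCast]
    norm_num
  rw [h, one_mul]
  exact_mod_cast prodE_proj p I hI
end

section
/- Let R₂ | S₂ := (C₆* | C₆) ⊠ (C₆* | C₆), a conditional predicate of arity 4 over {0,1,2}, and let P₃ := {0101,1111,1220,2222,2012} ⊆ {0,1,2}⁴ and Q₃ := P₃ ∪ {0000}. Then there exists a sequence 𝓘 = (I₁, I₂, I₃, I₄) of subsets of [4], each of size 3, such that R₂ | S₂ is an 𝓘-substructure of P₃ | Q₃. -/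
open Set

/-- `P₁ = π_{{1,3,4}} Cat₅ = {001,111,120,222,212}` over `{0,1,2}`. -/
def CatP1 : Set (Fin 3 → Fin 3) := {![0,0,1], ![1,1,1], ![1,2,0], ![2,2,2], ![2,1,2]}

/-- `Q₁ = P₁ ∪ {000}`. -/
def CatQ1 : Set (Fin 3 → Fin 3) := CatP1 ∪ {![0,0,0]}

/-- `P₂ = π_{{1,2,4}} Cat₅ = {011,111,120,222,202}` over `{0,1,2}`. -/
def CatP2 : Set (Fin 3 → Fin 3) := {![0,1,1], ![1,1,1], ![1,2,0], ![2,2,2], ![2,0,2]}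

/-- `Q₂ = P₂ ∪ {000}`. -/
def CatQ2 : Set (Fin 3 → Fin 3) := CatP2 ∪ {![0,0,0]}

/-- `P₃ = π_{{1,2,3,4}} Cat₅ = {0101,1111,1220,2222,2012}` over `{0,1,2}`. -/
def CatP3 : Set (Fin 4 → Fin 3) :=
  {![0,1,0,1], ![1,1,1,1], ![1,2,2,0], ![2,2,2,2], ![2,0,1,2]}

/-- `Q₃ = P₃ ∪ {0000}`. -/
def CatQ3 : Set (Fin 4 → Fin 3) := CatP3 ∪ {![0,0,0,0]}

/-- Table for the map `g` at coordinate 0 (which ignores variable 0). -/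
def tab0 : Fin 3 → Fin 3 → Fin 3 → Fin 3 :=
  ![![![0, 1, 0], ![0, 0, 1], ![0, 2, 2]],
    ![![2, 2, 0], ![1, 0, 1], ![0, 2, 2]],
    ![![1, 1, 0], ![1, 0, 1], ![0, 2, 2]]]

/-- Table for the map `g` at coordinate 1 (which ignores variable 1). -/
def tab1 : Fin 3 → Fin 3 → Fin 3 → Fin 3 :=
  ![![![0, 2, 0], ![1, 0, 1], ![0, 2, 0]],
    ![![1, 1, 0], ![1, 0, 1], ![0, 0, 0]],
    ![![2, 2, 0], ![2, 0, 2], ![0, 2, 2]]]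

/-- Table for the map `g` at coordinate 2 (which ignores variable 2). -/
def tab2 : Fin 3 → Fin 3 → Fin 3 → Fin 3 :=
  ![![![0, 2, 1], ![1, 2, 1], ![0, 0, 0]],
    ![![0, 1, 1], ![0, 0, 0], ![1, 1, 1]],
    ![![0, 0, 0], ![2, 2, 2], ![2, 2, 2]]]

/-- Table for the map `g` at coordinate 3 (which ignores variable 3). -/
def tab3 : Fin 3 → Fin 3 → Fin 3 → Fin 3 :=
  ![![![0, 1, 2], ![2, 1, 2], ![0, 0, 0]],
    ![![1, 1, 2], ![0, 0, 0], ![1, 1, 2]],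
    ![![0, 0, 0], ![2, 0, 2], ![0, 0, 2]]]

/-- The variable ignored by coordinate `j`. -/
def skipVar : Fin 4 → Fin 2 ⊕ Fin 2 := ![Sum.inl 0, Sum.inl 1, Sum.inr 0, Sum.inr 1]

/-- The four maps, as functions of a full assignment. -/
def fullMap (x : Fin 2 ⊕ Fin 2 → Fin 3) : Fin 4 → Fin 3 :=
  ![tab0 (x (Sum.inl 1)) (x (Sum.inr 0)) (x (Sum.inr 1)),
    tab1 (x (Sum.inl 0)) (x (Sum.inr 0)) (x (Sum.inr 1)),
    tab2 (x (Sum.inl 0)) (x (Sum.inl 1)) (x (Sum.inr 1)),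
    tab3 (x (Sum.inl 0)) (x (Sum.inl 1)) (x (Sum.inr 0))]

/-- Extend a partial assignment by `0` at the skipVar variable. -/
def extendZero (j : Fin 4) (y : ↥({skipVar j}ᶜ : Set (Fin 2 ⊕ Fin 2)) → Fin 3) :
    Fin 2 ⊕ Fin 2 → Fin 3 :=
  fun i => if h : i = skipVar j then 0 else y ⟨i, h⟩

lemma fullMap_extendZero (x : Fin 2 ⊕ Fin 2 → Fin 3) (j : Fin 4) :
    fullMap (extendZero j (fun i => x i.1)) j = fullMap x j := by
  fin_cases j <;> simp [fullMap, extendZero, skipVar]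

instance decC6 (x : Fin 2 → Fin 3) : Decidable (x ∈ C6) :=
  decidable_of_iff (x = ![0,0] ∨ x = ![0,1] ∨ x = ![1,0] ∨ x = ![1,2] ∨ x = ![2,1] ∨ x = ![2,2])
    (by simp [C6])

instance decC6star (x : Fin 2 → Fin 3) : Decidable (x ∈ C6star) :=
  decidable_of_iff (x ∈ C6 ∧ ¬ x = ![0,0]) (by simp [C6star])

instance decCatP3 (x : Fin 4 → Fin 3) : Decidable (x ∈ CatP3) :=
  decidable_of_iff (x = ![0,1,0,1] ∨ x = ![1,1,1,1] ∨ x = ![1,2,2,0] ∨ x = ![2,2,2,2] ∨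
    x = ![2,0,1,2]) (by simp [CatP3])

instance decCatQ3 (x : Fin 4 → Fin 3) : Decidable (x ∈ CatQ3) :=
  decidable_of_iff (x ∈ CatP3 ∨ x = ![0,0,0,0]) (by simp [CatQ3, or_comm])

instance decBoxP (x : Fin 2 ⊕ Fin 2 → Fin 3) : Decidable (x ∈ boxP C6star C6 C6star C6) :=
  inferInstanceAs (Decidable ((_ ∧ _) ∨ (_ ∧ _)))

instance decBoxQ (x : Fin 2 ⊕ Fin 2 → Fin 3) : Decidable (x ∈ boxQ C6 C6) :=
  inferInstanceAs (Decidable (_ ∧ _))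

set_option maxRecDepth 100000 in
lemma fullMap_spec : ∀ a b c d : Fin 3,
    (Sum.elim ![a, b] ![c, d] ∈ boxP C6star C6 C6star C6 →
      fullMap (Sum.elim ![a, b] ![c, d]) ∈ CatP3) ∧
    (Sum.elim ![a, b] ![c, d] ∈ boxQ C6 C6 → Sum.elim ![a, b] ![c, d] ∉ boxP C6star C6 C6star C6 →
      fullMap (Sum.elim ![a, b] ![c, d]) ∈ CatQ3 ∧
      fullMap (Sum.elim ![a, b] ![c, d]) ∉ CatP3) := by
  decide

lemma eq_elim (x : Fin 2 ⊕ Fin 2 → Fin 3) :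
    x = Sum.elim ![x (Sum.inl 0), x (Sum.inl 1)] ![x (Sum.inr 0), x (Sum.inr 1)] := by
  funext i
  rcases i with i | i <;> fin_cases i <;> rfl

/-- Lemma: there is a sequence `𝓘` of subsets of [4] (here: of `Fin 2 ⊕ Fin 2`),
each of size 3, such that `R₂ | S₂ = (C₆* | C₆) ⊠ (C₆* | C₆)` is an `𝓘`-substructure
of the Catalan projection `P₃ | Q₃`. -/
theorem R2S2_substructure_of_P3Q3 :
    ∃ 𝓘 : Fin 4 → Set (Fin 2 ⊕ Fin 2),
      (∀ j, (𝓘 j).ncard = 3) ∧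
      IsSubstructure (boxP C6star C6 C6star C6) (boxQ C6 C6) CatP3 CatQ3 𝓘 := by
  refine ⟨fun j => {skipVar j}ᶜ, fun j => ?_, fun j y => fullMap (extendZero j y) j, ?_, ?_⟩
  · rw [Set.ncard_compl, Set.ncard_singleton]
    simp
  · intro x hx
    simp only [fullMap_extendZero]
    have h := (fullMap_spec (x (Sum.inl 0)) (x (Sum.inl 1)) (x (Sum.inr 0)) (x (Sum.inr 1))).1
    rw [← eq_elim x] at h
    exact h hx
  · intro x hx
    simp only [fullMap_extendZero]
    have h := (fullMap_spec (x (Sum.inl 0)) (x (Sum.inl 1)) (x (Sum.inr 0)) (x (Sum.inr 1))).2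
    rw [← eq_elim x] at h
    exact h hx.1 hx.2
end
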